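/- Herbrand's theorem, implicational form: let A and B be quantifier-free, equality-free first-order formulas, with free variables of A among x₁,…,xₙ and of B among y₁,…,yₖ, and let F be the set of function symbols occurring in A or in B. Then ∀x₁…∀xₙ A semantically implies ∃y₁…∃yₖ B (every structure with nonempty domain satisfying the former satisfies the latter) if and only if the sets Γ, Δ of Herbrand instances of A, resp. B, with respect to F are such that every propositional interpretation making all members of Γ true makes at least one member of Δ true. -/

import Mathlib

/-- First-order terms over a family `Fn` of function symbols (with `Fn n` the
`n`-ary symbols; 0-ary symbols are constants), with individual variables
indexed by ℕ. -/
inductive Term (Fn : ℕ → Type) : Type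
  | var : ℕ → Term Fn
  | app : {n : ℕ} → Fn n → (Fin n → Term Fn) → Term Fn

/-- Quantifier-free, equality-free first-order formulas over function symbols
`Fn` and relation symbols `Rl`. -/
inductive QFForm (Fn Rl : ℕ → Type) : Type
  | atom : {n : ℕ} → Rl n → (Fin n → Term Fn) → QFForm Fn Rl
  | neg : QFForm Fn Rl → QFForm Fn Rl
  | conj : QFForm Fn Rl → QFForm Fn Rl → QFForm Fn Rl
  | disj : QFForm Fn Rl → QFForm Fn Rl → QFForm Fn Rl

variable {Fn Rl : ℕ → Type}

/-- The variable `x` occurs in a term. -/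
inductive Term.UsesVar : Term Fn → ℕ → Prop
  | var (x : ℕ) : Term.UsesVar (.var x) x
  | app {n : ℕ} (f : Fn n) (ts : Fin n → Term Fn) (i : Fin n) (x : ℕ) :
      Term.UsesVar (ts i) x → Term.UsesVar (.app f ts) x

/-- The variable `x` occurs (free) in a quantifier-free formula. -/
inductive QFForm.UsesVar : QFForm Fn Rl → ℕ → Prop
  | atom {n : ℕ} (R : Rl n) (ts : Fin n → Term Fn) (i : Fin n) (x : ℕ) :
      Term.UsesVar (ts i) x → QFForm.UsesVar (.atom R ts) x
  | neg (A : QFForm Fn Rl) (x : ℕ) :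
      QFForm.UsesVar A x → QFForm.UsesVar (.neg A) x
  | conjL (A B : QFForm Fn Rl) (x : ℕ) :
      QFForm.UsesVar A x → QFForm.UsesVar (.conj A B) x
  | conjR (A B : QFForm Fn Rl) (x : ℕ) :
      QFForm.UsesVar B x → QFForm.UsesVar (.conj A B) x
  | disjL (A B : QFForm Fn Rl) (x : ℕ) :
      QFForm.UsesVar A x → QFForm.UsesVar (.disj A B) x
  | disjR (A B : QFForm Fn Rl) (x : ℕ) :
      QFForm.UsesVar B x → QFForm.UsesVar (.disj A B) x

/-- The function symbol `f` occurs in a term. -/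
inductive Term.UsesFn : Term Fn → ∀ n : ℕ, Fn n → Prop
  | here {n : ℕ} (f : Fn n) (ts : Fin n → Term Fn) :
      Term.UsesFn (.app f ts) n f
  | there {n : ℕ} (f : Fn n) (ts : Fin n → Term Fn) (i : Fin n)
      {m : ℕ} (g : Fn m) :
      Term.UsesFn (ts i) m g → Term.UsesFn (.app f ts) m g

/-- The function symbol `f` occurs in a quantifier-free formula. -/
inductive QFForm.UsesFn : QFForm Fn Rl → ∀ n : ℕ, Fn n → Prop
  | atom {n : ℕ} (R : Rl n) (ts : Fin n → Term Fn) (i : Fin n)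
      {m : ℕ} (g : Fn m) :
      Term.UsesFn (ts i) m g → QFForm.UsesFn (.atom R ts) m g
  | neg (A : QFForm Fn Rl) {m : ℕ} (g : Fn m) :
      QFForm.UsesFn A m g → QFForm.UsesFn (.neg A) m g
  | conjL (A B : QFForm Fn Rl) {m : ℕ} (g : Fn m) :
      QFForm.UsesFn A m g → QFForm.UsesFn (.conj A B) m g
  | conjR (A B : QFForm Fn Rl) {m : ℕ} (g : Fn m) :
      QFForm.UsesFn B m g → QFForm.UsesFn (.conj A B) m g
  | disjL (A B : QFForm Fn Rl) {m : ℕ} (g : Fn m) :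
      QFForm.UsesFn A m g → QFForm.UsesFn (.disj A B) m g
  | disjR (A B : QFForm Fn Rl) {m : ℕ} (g : Fn m) :
      QFForm.UsesFn B m g → QFForm.UsesFn (.disj A B) m g

/-- A term is built from individual variables and function symbols
satisfying `P` only. -/
inductive Term.OnlyFns (P : ∀ n : ℕ, Fn n → Prop) : Term Fn → Prop
  | var (x : ℕ) : Term.OnlyFns P (.var x)
  | app {n : ℕ} (f : Fn n) (ts : Fin n → Term Fn) :
      P n f → (∀ i, Term.OnlyFns P (ts i)) → Term.OnlyFns P (.app f ts)

/-- Uniform substitution of terms for variables, in a term. -/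
def Term.subst (θ : ℕ → Term Fn) : Term Fn → Term Fn
  | .var x => θ x
  | .app f ts => .app f fun i => (ts i).subst θ

/-- Uniform substitution of terms for (the free occurrences of) variables,
in a quantifier-free formula. -/
def QFForm.subst (θ : ℕ → Term Fn) : QFForm Fn Rl → QFForm Fn Rl
  | .atom R ts => .atom R fun i => (ts i).subst θ
  | .neg A => .neg (A.subst θ)
  | .conj A B => .conj (A.subst θ) (B.subst θ)
  | .disj A B => .disj (A.subst θ) (B.subst θ)

/-- Evaluation of a term in a structure with domain `D`, function
interpretation `fI` and variable assignment `v`. -/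
def Term.eval {D : Type} (fI : ∀ n : ℕ, Fn n → (Fin n → D) → D)
    (v : ℕ → D) : Term Fn → D
  | .var x => v x
  | .app f ts => fI _ f fun i => (ts i).eval fI v

/-- Truth of a quantifier-free formula in a structure (domain `D`, function
interpretation `fI`, relation interpretation `rI`) under an assignment `v`. -/
def QFForm.eval {D : Type} (fI : ∀ n : ℕ, Fn n → (Fin n → D) → D)
    (rI : ∀ n : ℕ, Rl n → (Fin n → D) → Prop) (v : ℕ → D) :
    QFForm Fn Rl → Prop
  | .atom R ts => rI _ R fun i => (ts i).eval fI v
  | .neg A => ¬ A.eval fI rI v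
  | .conj A B => A.eval fI rI v ∧ B.eval fI rI v
  | .disj A B => A.eval fI rI v ∨ B.eval fI rI v

/-- Truth-functional evaluation of a quantifier-free formula under a
propositional interpretation `π`, which assigns a truth-value to every
atomic formula. -/
def QFForm.evalProp (π : ∀ n : ℕ, Rl n → (Fin n → Term Fn) → Prop) :
    QFForm Fn Rl → Prop
  | .atom R ts => π _ R ts
  | .neg A => ¬ A.evalProp π
  | .conj A B => A.evalProp π ∧ B.evalProp π
  | .disj A B => A.evalProp π ∨ B.evalProp π

/-- `θ` is a Herbrand substitution for the variables below `n`, with respect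
to the function symbols satisfying `P`: it substitutes, for each variable
below `n`, a term built from individual variables and function symbols
satisfying `P`, and leaves all other variables unchanged. -/
def HerbrandSubst (P : ∀ n : ℕ, Fn n → Prop) (n : ℕ) (θ : ℕ → Term Fn) : Prop :=
  (∀ x, x < n → (θ x).OnlyFns P) ∧ ∀ x, n ≤ x → θ x = .var x

theorem Term.subst_congr_aux (θ θ' : ℕ → Term Fn) (t : Term Fn)
    (h : ∀ x, t.UsesVar x → θ x = θ' x) : t.subst θ = t.subst θ' := by
  induction t with
  | var x => exact h x (.var x)
  | app f ts ih =>
    simp only [Term.subst]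
    congr 1
    funext i
    exact ih i fun x hx => h x (.app f ts i x hx)

theorem QFForm.subst_congr_aux (θ θ' : ℕ → Term Fn) (A : QFForm Fn Rl)
    (h : ∀ x, A.UsesVar x → θ x = θ' x) : A.subst θ = A.subst θ' := by
  induction A with
  | atom R ts =>
    simp only [QFForm.subst]
    congr 1
    funext i
    exact Term.subst_congr_aux _ _ _ fun x hx => h x (.atom R ts i x hx)
  | neg A ih =>
    simp only [QFForm.subst]
    rw [ih fun x hx => h x (.neg A x hx)]
  | conj A B ih1 ih2 =>
    simp only [QFForm.subst]
    rw [ih1 fun x hx => h x (.conjL A B x hx), ih2 fun x hx => h x (.conjR A B x hx)]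
  | disj A B ih1 ih2 =>
    simp only [QFForm.subst]
    rw [ih1 fun x hx => h x (.disjL A B x hx), ih2 fun x hx => h x (.disjR A B x hx)]

theorem Term.eval_subst_aux {D : Type} (fI : ∀ n : ℕ, Fn n → (Fin n → D) → D)
    (v : ℕ → D) (θ : ℕ → Term Fn) (t : Term Fn) :
    (t.subst θ).eval fI v = t.eval fI (fun x => (θ x).eval fI v) := by
  induction t with
  | var x => rfl
  | app f ts ih => simp only [Term.subst, Term.eval, ih]

theorem QFForm.evalProp_subst_aux {D : Type} (fI : ∀ n : ℕ, Fn n → (Fin n → D) → D)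
    (rI : ∀ n : ℕ, Rl n → (Fin n → D) → Prop)
    (v : ℕ → D) (θ : ℕ → Term Fn) (A : QFForm Fn Rl) :
    (A.subst θ).evalProp (fun m R ts => rI m R fun i => (ts i).eval fI v) ↔
      A.eval fI rI (fun x => (θ x).eval fI v) := by
  induction A with
  | atom R ts => simp only [QFForm.subst, QFForm.evalProp, QFForm.eval, Term.eval_subst_aux]
  | neg A ih => simp only [QFForm.subst, QFForm.evalProp, QFForm.eval, ih]
  | conj A B ih1 ih2 => simp only [QFForm.subst, QFForm.evalProp, QFForm.eval, ih1, ih2]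
  | disj A B ih1 ih2 => simp only [QFForm.subst, QFForm.evalProp, QFForm.eval, ih1, ih2]

open Classical in
/-- Function interpretation of the restricted term model. -/
noncomputable def herbFn (P : ∀ n : ℕ, Fn n → Prop) (m : ℕ) (f : Fn m)
    (ts : Fin m → {t : Term Fn // t.OnlyFns P}) : {t : Term Fn // t.OnlyFns P} :=
  if h : P m f then ⟨.app f fun i => (ts i).1, .app f _ h fun i => (ts i).2⟩
  else ⟨.var 0, .var 0⟩

theorem herb_term (P : ∀ n : ℕ, Fn n → Prop) (v : ℕ → {t : Term Fn // t.OnlyFns P})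
    (t : Term Fn) (h : ∀ m f, t.UsesFn m f → P m f) :
    (t.eval (herbFn P) v).1 = t.subst (fun x => (v x).1) := by
  induction t with
  | var x => rfl
  | app f ts ih =>
    simp only [Term.subst, Term.eval]
    rw [herbFn, dif_pos (h _ f (.here f ts))]
    simp only
    congr 1
    funext i
    exact ih i fun m g hg => h m g (.there f ts i g hg)

theorem herb_form (P : ∀ n : ℕ, Fn n → Prop)
    (π : ∀ m : ℕ, Rl m → (Fin m → Term Fn) → Prop)
    (v : ℕ → {t : Term Fn // t.OnlyFns P})
    (A : QFForm Fn Rl) (h : ∀ m f, A.UsesFn m f → P m f) :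
    A.eval (herbFn P) (fun m R ts => π m R fun i => (ts i).1) v ↔
      (A.subst (fun x => (v x).1)).evalProp π := by
  induction A with
  | atom R ts =>
    simp only [QFForm.subst, QFForm.evalProp, QFForm.eval]
    have : (fun i => ((ts i).eval (herbFn P) v).1)
        = fun i => (ts i).subst (fun x => (v x).1) := by
      funext i
      exact herb_term P v _ fun m g hg => h m g (.atom R ts i g hg)
    rw [this]
  | neg A ih =>
    simp only [QFForm.subst, QFForm.evalProp, QFForm.eval]
    rw [ih fun m g hg => h m g (.neg A g hg)]
  | conj A B ih1 ih2 =>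
    simp only [QFForm.subst, QFForm.evalProp, QFForm.eval]
    rw [ih1 fun m g hg => h m g (.conjL A B g hg), ih2 fun m g hg => h m g (.conjR A B g hg)]
  | disj A B ih1 ih2 =>
    simp only [QFForm.subst, QFForm.evalProp, QFForm.eval]
    rw [ih1 fun m g hg => h m g (.disjL A B g hg), ih2 fun m g hg => h m g (.disjR A B g hg)]

theorem herb_trunc (P : ∀ n : ℕ, Fn n → Prop) (v : ℕ → {t : Term Fn // t.OnlyFns P})
    (A : QFForm Fn Rl) (n : ℕ) (hA : ∀ x, A.UsesVar x → x < n) :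
    ∃ θ : ℕ → Term Fn, HerbrandSubst P n θ ∧ A.subst θ = A.subst (fun x => (v x).1) := by
  refine ⟨fun x => if x < n then (v x).1 else .var x, ⟨?_, ?_⟩, ?_⟩
  · intro x hx
    simp only [if_pos hx]
    exact (v x).2
  · intro x hx
    simp only [if_neg (not_lt.mpr hx)]
  · apply QFForm.subst_congr_aux
    intro x hx
    simp only [if_pos (hA x hx)]

/-- Herbrand's theorem, implicational form: for quantifier-free,
equality-free `A` (free variables among the first `n` variables) and `B`
(free variables among the first `k` variables), and `F` the function symbols
occurring in `A` or in `B`: the universal closure of `A` semantically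
implies the existential closure of `B` (over structures with nonempty
domain) iff every propositional interpretation making all Herbrand instances
of `A` w.r.t. `F` true makes at least one Herbrand instance of `B` w.r.t.
`F` true. -/
theorem herbrand_implication (Fn Rl : ℕ → Type) (A B : QFForm Fn Rl)
    (n k : ℕ) (hA : ∀ x, A.UsesVar x → x < n)
    (hB : ∀ x, B.UsesVar x → x < k) :
    (∀ (D : Type), Nonempty D →
      ∀ (fI : ∀ m : ℕ, Fn m → (Fin m → D) → D)
        (rI : ∀ m : ℕ, Rl m → (Fin m → D) → Prop),
        (∀ v : ℕ → D, A.eval fI rI v) → ∃ v : ℕ → D, B.eval fI rI v) ↔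
    (∀ π : ∀ m : ℕ, Rl m → (Fin m → Term Fn) → Prop,
      (∀ θ : ℕ → Term Fn,
        HerbrandSubst (fun m f => A.UsesFn m f ∨ B.UsesFn m f) n θ →
        (A.subst θ).evalProp π) →
      ∃ θ : ℕ → Term Fn,
        HerbrandSubst (fun m f => A.UsesFn m f ∨ B.UsesFn m f) k θ ∧
        (B.subst θ).evalProp π) := by
  constructor
  · intro H π hπ
    obtain ⟨v, hv⟩ := H {t : Term Fn // t.OnlyFns fun m f => A.UsesFn m f ∨ B.UsesFn m f}
      ⟨⟨.var 0, .var 0⟩⟩ (herbFn _) (fun m R ts => π m R fun i => (ts i).1) (by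
        intro v
        rw [herb_form _ π v A fun m f h => Or.inl h]
        obtain ⟨θ, h1, h2⟩ := herb_trunc _ v A n hA
        rw [← h2]
        exact hπ θ h1)
    rw [herb_form _ π v B fun m f h => Or.inr h] at hv
    obtain ⟨θ, h1, h2⟩ := herb_trunc _ v B k hB
    exact ⟨θ, h1, h2 ▸ hv⟩
  · rintro H D ⟨d⟩ fI rI hAll
    obtain ⟨θ, -, h⟩ := H (fun m R ts => rI m R fun i => (ts i).eval fI fun _ => d)
      (fun θ _ => (QFForm.evalProp_subst_aux fI rI (fun _ => d) θ A).2 (hAll _))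
    exact ⟨_, (QFForm.evalProp_subst_aux fI rI (fun _ => d) θ B).1 h⟩
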